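/- Let q be a power of an odd prime p, write n = p^k u with gcd(u, p) = 1, and let q' be the largest squarefree divisor of q^n − 1. Let p_1, …, p_s be distinct primes dividing q' (possibly s = 0) such that δ := 1 − Σ_{i=1}^s 1/p_i > 0, and set q_0 := q'/(p_1 ⋯ p_s). If q^{p^k (u/2 − 1)} > W(q_0) · W(x^u − 1) · ((s − 1)/δ + 2), then there exists an element of F_{q^n} that is simultaneously 2-primitive and 1-normal over F_q. -/

import Mathlib

open Polynomial

/-- The `F_q`-span of the conjugates `α, α^q, …, α^{q^{n-1}}` of `α ∈ F_{q^n}`. -/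
def conjSpan (K : Type*) {L : Type*} [Field K] [Field L] [Algebra K L]
    (q n : ℕ) (α : L) : Submodule K L :=
  Submodule.span K (Set.range fun i : Fin n => α ^ q ^ (i : ℕ))

/-- `W(t) = 2^{ω(t)}`, the number of squarefree divisors of the positive integer `t`. -/
def Wnat (t : ℕ) : ℕ := 2 ^ t.primeFactors.card

/-- `W(f)`, the number of monic squarefree divisors of `f` in `F_q[x]`. -/
noncomputable def Wpoly {K : Type*} [Field K] (f : Polynomial K) : ℕ :=
  Set.ncard {d : Polynomial K | d.Monic ∧ Squarefree d ∧ d ∣ f}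

section CharacterSums

variable {F : Type*} [Field F] [Fintype F]

theorem norm_mulChar_apply_eq_one (χ : MulChar F ℂ) {a : F} (ha : a ≠ 0) : ‖χ a‖ = 1 := by
  refine Complex.norm_eq_one_of_pow_eq_one (n := Fintype.card F - 1) ?_ ?_
  · rw [← map_pow, FiniteField.pow_card_sub_one_eq_one a ha, map_one]
  · have := Fintype.one_lt_card (α := F)
    omega

theorem norm_mulChar_apply_le_one (χ : MulChar F ℂ) (a : F) : ‖χ a‖ ≤ 1 := by
  by_cases ha : a = 0
  · simp [ha, MulChar.map_zero]
  · exact (norm_mulChar_apply_eq_one χ ha).le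

/-- The second moment of the quadratic sums `∑ χ(w) ψ(b w²)` over all `b`. -/
theorem sum_norm_sq_quadratic_sum_le (χ : MulChar F ℂ) {ψ : AddChar F ℂ} (hψ : ψ ≠ 1) :
    ∑ b : F, ‖∑ w : F, χ w * ψ (b * w ^ 2)‖ ^ 2 ≤
      2 * Fintype.card F * ((Fintype.card F : ℝ) - 1) := by
  classical
  have hprim := AddChar.IsPrimitive.of_ne_one hψ
  have key : ((∑ b : F, ‖∑ w : F, χ w * ψ (b * w ^ 2)‖ ^ 2 : ℝ) : ℂ) =
      ∑ w : F, ∑ v : F, χ w * (starRingEnd ℂ) (χ v) *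
        (if w ^ 2 - v ^ 2 = 0 then (Fintype.card F : ℂ) else 0) := by
    push_cast
    simp_rw [← Complex.mul_conj', map_sum, Finset.sum_mul_sum]
    rw [Finset.sum_comm]
    refine Finset.sum_congr rfl fun w _ => ?_
    rw [Finset.sum_comm]
    refine Finset.sum_congr rfl fun v _ => ?_
    have := AddChar.sum_mulShift (w ^ 2 - v ^ 2) hprim
    push_cast at this
    rw [← this, Finset.mul_sum]
    refine Finset.sum_congr rfl fun b _ => ?_
    rw [map_mul (starRingEnd ℂ), ← AddChar.map_neg_eq_conj, mul_sub, sub_eq_add_neg,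
      AddChar.map_add_eq_mul]
    ring
  have bound : ∀ w : F, ‖∑ v : F, χ w * (starRingEnd ℂ) (χ v) *
        (if w ^ 2 - v ^ 2 = 0 then (Fintype.card F : ℂ) else 0)‖ ≤
        if w = 0 then 0 else 2 * (Fintype.card F : ℝ) := by
    intro w
    by_cases hw : w = 0
    · simp [hw, MulChar.map_zero]
    rw [if_neg hw]
    refine (norm_sum_le _ _).trans ?_
    have h1 : ∀ v : F, ‖χ w * (starRingEnd ℂ) (χ v) *
        (if w ^ 2 - v ^ 2 = 0 then (Fintype.card F : ℂ) else 0)‖ ≤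
        if v ∈ ({w, -w} : Finset F) then (Fintype.card F : ℝ) else 0 := by
      intro v
      by_cases hv : w ^ 2 - v ^ 2 = 0
      · have hmem : v ∈ ({w, -w} : Finset F) := by
          have : v ^ 2 = w ^ 2 := (sub_eq_zero.1 hv).symm
          simpa using sq_eq_sq_iff_eq_or_eq_neg.1 this
        rw [if_pos hv, if_pos hmem, norm_mul, norm_mul, RCLike.norm_conj, Complex.norm_natCast]
        have := mul_le_one₀ (norm_mulChar_apply_le_one χ w) (norm_nonneg _)
          (norm_mulChar_apply_le_one χ v)
        nlinarith [Nat.cast_nonneg (α := ℝ) (Fintype.card F)]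
      · rw [if_neg hv, mul_zero, norm_zero]
        split_ifs <;> positivity
    refine (Finset.sum_le_sum fun v _ => h1 v).trans ?_
    rw [Finset.sum_ite_mem, Finset.univ_inter, Finset.sum_const, nsmul_eq_mul]
    gcongr
    exact_mod_cast Finset.card_le_two
  have hnn : 0 ≤ ∑ b : F, ‖∑ w : F, χ w * ψ (b * w ^ 2)‖ ^ 2 := by positivity
  have := congrArg norm key
  rw [Complex.norm_real, Real.norm_of_nonneg hnn] at this
  rw [this]
  refine (norm_sum_le _ _).trans ((Finset.sum_le_sum fun w _ => bound w).trans (le_of_eq ?_))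
  rw [← Finset.sum_erase_add _ _ (Finset.mem_univ (0 : F)), if_pos rfl, add_zero,
    Finset.sum_congr rfl (g := fun _ => 2 * (Fintype.card F : ℝ))
      (fun x hx => if_neg (Finset.ne_of_mem_erase hx)), Finset.sum_const,
    Finset.card_erase_of_mem (Finset.mem_univ _), Finset.card_univ, nsmul_eq_mul,
    Nat.cast_sub Fintype.card_pos]
  push_cast
  ring

theorem norm_quadratic_sum_le (χ : MulChar F ℂ) {ψ : AddChar F ℂ} (hψ : ψ ≠ 1) :
    ‖∑ w : F, χ w * ψ (w ^ 2)‖ ≤ 2 * √(Fintype.card F) := by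
  classical
  set T : F → ℂ := fun b => ∑ w : F, χ w * ψ (b * w ^ 2) with hT
  have hT1 : ∑ w : F, χ w * ψ (w ^ 2) = T 1 := by simp [hT]
  have hunit : ∀ y : F, y ≠ 0 → ‖T (y ^ 2)‖ = ‖T 1‖ := by
    intro y hy
    have : χ y * T (y ^ 2) = T 1 := by
      simp only [hT, Finset.mul_sum]
      refine Fintype.sum_equiv (Equiv.mulLeft₀ y hy) _ _ fun w => ?_
      change χ y * (χ w * ψ (y ^ 2 * w ^ 2)) = χ (y * w) * ψ (1 * (y * w) ^ 2)
      rw [one_mul, mul_pow, map_mul χ]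
      ring
    rw [← this, norm_mul, norm_mulChar_apply_eq_one χ hy, one_mul]
  have hfib : ∑ y ∈ Finset.univ.erase (0 : F), ‖T (y ^ 2)‖ ^ 2 ≤ 2 * ∑ b : F, ‖T b‖ ^ 2 := by
    rw [← Finset.sum_fiberwise_of_maps_to (t := Finset.univ) (g := fun y : F => y ^ 2)
      (fun _ _ => Finset.mem_univ _), Finset.mul_sum]
    refine Finset.sum_le_sum fun b _ => ?_
    rw [Finset.sum_congr rfl (g := fun _ => ‖T b‖ ^ 2)
      (fun x hx => by rw [(Finset.mem_filter.1 hx).2]), Finset.sum_const, nsmul_eq_mul]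
    gcongr
    have : ((Finset.univ.erase (0 : F)).filter fun y => y ^ 2 = b).card ≤ 2 := by
      rcases ((Finset.univ.erase (0 : F)).filter fun y => y ^ 2 = b).eq_empty_or_nonempty with
        h | ⟨z, hz⟩
      · simp [h]
      · refine (Finset.card_le_card (t := {z, -z}) fun y hy => ?_).trans Finset.card_le_two
        have : y ^ 2 = z ^ 2 := by
          rw [(Finset.mem_filter.1 hy).2, (Finset.mem_filter.1 hz).2]
        simpa using sq_eq_sq_iff_eq_or_eq_neg.1 this
    exact_mod_cast this
  rw [Finset.sum_congr rfl (g := fun _ => ‖T 1‖ ^ 2)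
      (fun x hx => by rw [hunit x (Finset.ne_of_mem_erase hx)]), Finset.sum_const,
    Finset.card_erase_of_mem (Finset.mem_univ _), Finset.card_univ, nsmul_eq_mul,
    Nat.cast_sub Fintype.card_pos] at hfib
  have hcard : (1 : ℝ) < Fintype.card F := by exact_mod_cast Fintype.one_lt_card
  have h2 := sum_norm_sq_quadratic_sum_le χ hψ
  have h3 : ‖T 1‖ ^ 2 ≤ 4 * Fintype.card F := by
    have : ((Fintype.card F : ℝ) - 1) * ‖T 1‖ ^ 2 ≤
        ((Fintype.card F : ℝ) - 1) * (4 * Fintype.card F) := by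
      push_cast at hfib
      linarith
    exact le_of_mul_le_mul_left this (by linarith)
  rw [hT1]
  refine abs_le_of_sq_le_sq' ?_ (by positivity) |>.2
  rw [mul_pow, Real.sq_sqrt (by positivity)]
  linarith

end CharacterSums

section Sieve

/-- The coefficients of the expansion of the indicator of `z ≠ 1`, for an `r`-th root of
unity `z`, in the powers `z ^ j`, normalised to have constant coefficient `1`. -/
noncomputable def sieveCoeff (r j : ℕ) : ℂ := if j = 0 then 1 else -1 / ((r : ℂ) - 1)

theorem sum_sieveCoeff_mul_pow {r : ℕ} (hr : 1 < r) {z : ℂ} (hz : z ^ r = 1) :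
    ∑ j ∈ Finset.range r, sieveCoeff r j * z ^ j =
      if z = 1 then 0 else (r : ℂ) / ((r : ℂ) - 1) := by
  obtain ⟨m, rfl⟩ : ∃ m, r = m + 1 := ⟨r - 1, by omega⟩
  have hm : (m : ℂ) ≠ 0 := by
    have : m ≠ 0 := by omega
    exact_mod_cast this
  rw [Finset.sum_range_succ']
  have h1 : ∀ j ∈ Finset.range m, sieveCoeff (m + 1) (j + 1) * z ^ (j + 1) =
      -1 / (m : ℂ) * z ^ (j + 1) := by
    intro j _
    simp [sieveCoeff]
  rw [Finset.sum_congr rfl h1, ← Finset.mul_sum]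
  have h0 : sieveCoeff (m + 1) 0 * z ^ 0 = 1 := by simp [sieveCoeff]
  rw [h0]
  push_cast
  split_ifs with h
  · simp [h, hm]
  · have hg := Finset.sum_range_succ' (fun j => z ^ j) m
    have hgeom : ∑ j ∈ Finset.range (m + 1), z ^ j = 0 := by
      rw [geom_sum_eq h, hz, sub_self, zero_div]
    rw [hgeom, pow_zero] at hg
    rw [eq_neg_of_add_eq_zero_left hg.symm, add_sub_cancel_right]
    field_simp
    ring

theorem sum_norm_sieveCoeff {r : ℕ} (hr : 1 < r) :
    ∑ j ∈ Finset.range r, ‖sieveCoeff r j‖ = 2 := by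
  obtain ⟨m, rfl⟩ : ∃ m, r = m + 1 := ⟨r - 1, by omega⟩
  have hm : (m : ℝ) ≠ 0 := by
    have : m ≠ 0 := by omega
    exact_mod_cast this
  rw [Finset.sum_range_succ']
  simp [sieveCoeff, hm]
  norm_num

variable {I : Type*} [Fintype I] [DecidableEq I]

/-- Exponent vectors supported on `M`, with the `i`-th entry below `r i`. -/
def sieveExponents (r : I → ℕ) (M : Finset I) : Finset (I → ℕ) :=
  Fintype.piFinset fun i => if i ∈ M then Finset.range (r i) else {0}

theorem lt_of_mem_sieveExponents {r : I → ℕ} (hr : ∀ i, 0 < r i) {M : Finset I} {j : I → ℕ}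
    (hj : j ∈ sieveExponents r M) (i : I) : j i < r i := by
  have := Fintype.mem_piFinset.1 hj i
  split_ifs at this
  · exact Finset.mem_range.1 this
  · rw [Finset.mem_singleton.1 this]
    exact hr i

theorem zero_mem_sieveExponents {r : I → ℕ} (hr : ∀ i, 0 < r i) (M : Finset I) :
    0 ∈ sieveExponents r M := by
  refine Fintype.mem_piFinset.2 fun i => ?_
  split_ifs
  · exact Finset.mem_range.2 (hr i)
  · simp

theorem sieveExponents_mono {r : I → ℕ} (hr : ∀ i, 0 < r i) {M N : Finset I} (h : M ⊆ N) :
    sieveExponents r M ⊆ sieveExponents r N := by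
  refine Fintype.piFinset_subset _ _ fun i => ?_
  by_cases hi : i ∈ M
  · rw [if_pos hi, if_pos (h hi)]
  · rw [if_neg hi, Finset.singleton_subset_iff]
    split_ifs
    · exact Finset.mem_range.2 (hr i)
    · simp

theorem sum_prod_norm_sieveCoeff {r : I → ℕ} (hr : ∀ i, 1 < r i) (M : Finset I) :
    ∑ j ∈ sieveExponents r M, ∏ i, ‖sieveCoeff (r i) (j i)‖ = 2 ^ M.card := by
  rw [sieveExponents, ← Finset.prod_univ_sum
    (fun i => if i ∈ M then Finset.range (r i) else {0}) (fun i k => ‖sieveCoeff (r i) k‖)]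
  have : ∀ i, ∑ j ∈ (if i ∈ M then Finset.range (r i) else {0}), ‖sieveCoeff (r i) j‖ =
      if i ∈ M then 2 else 1 := by
    intro i
    split_ifs
    · exact sum_norm_sieveCoeff (hr i)
    · simp [sieveCoeff]
  simp_rw [this]
  rw [Finset.prod_ite_mem, Finset.univ_inter, Finset.prod_const]

variable {F : Type*} [Field F]

theorem prod_mulChar_pow_apply (χ : I → MulChar F ℂ) (j : I → ℕ) {w : F} (hw : w ≠ 0) :
    (∏ i, χ i ^ j i) w = ∏ i, χ i w ^ j i := by
  obtain ⟨v, rfl⟩ := hw.isUnit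
  refine Finset.induction_on (Finset.univ : Finset I) (by simp) fun i s hi ih => ?_
  rw [Finset.prod_insert hi, Finset.prod_insert hi, MulChar.mul_apply, ih,
    MulChar.pow_apply_coe]

theorem eq_zero_of_prod_mulChar_pow_eq_one {χ : I → MulChar F ℂ} {r : I → ℕ}
    (hr : ∀ i, (r i).Prime) (hinj : Function.Injective r) (hχ : ∀ i, orderOf (χ i) = r i)
    {j : I → ℕ} (hj : ∀ i, j i < r i) (h : ∏ i, χ i ^ j i = 1) : j = 0 := by
  funext i
  set m := ∏ k ∈ Finset.univ.erase i, r k with hm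
  have h1 : (∏ k, χ k ^ j k) ^ m = χ i ^ (j i * m) := by
    rw [← Finset.prod_pow, ← Finset.mul_prod_erase _ _ (Finset.mem_univ i), ← pow_mul,
      Finset.prod_eq_one, mul_one]
    intro k hk
    rw [← pow_mul]
    refine orderOf_dvd_iff_pow_eq_one.1 ?_
    rw [hχ]
    exact Dvd.dvd.mul_left (Finset.dvd_prod_of_mem r hk) _
  rw [h, one_pow] at h1
  have h2 : r i ∣ j i * m := by
    rw [← hχ]
    exact orderOf_dvd_of_pow_eq_one h1.symm
  rcases (hr i).dvd_mul.1 h2 with h3 | h3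
  · exact Nat.eq_zero_of_dvd_of_lt h3 (hj i)
  · obtain ⟨k, hk, hdvd⟩ := ((hr i).prime.dvd_finsetProd_iff _).1 h3
    have := hinj ((Nat.prime_dvd_prime_iff_eq (hr i) (hr k)).1 hdvd)
    exact absurd this.symm (Finset.ne_of_mem_erase hk)

/-- The normalised weight of the elements `w` with `χ i w ≠ 1` for all `i ∈ M`. -/
noncomputable def sieveWeight (χ : I → MulChar F ℂ) (r : I → ℕ) (M : Finset I) (w : F) : ℂ :=
  ∑ j ∈ sieveExponents r M, (∏ i, sieveCoeff (r i) (j i)) * (∏ i, χ i ^ j i) w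

theorem sieveWeight_zero (χ : I → MulChar F ℂ) (r : I → ℕ) (M : Finset I) :
    sieveWeight χ r M 0 = 0 :=
  Finset.sum_eq_zero fun j _ => by rw [MulChar.map_zero, mul_zero]

theorem prod_mul_sieveWeight {χ : I → MulChar F ℂ} {r : I → ℕ} (hr : ∀ i, 1 < r i)
    (hχ : ∀ i, orderOf (χ i) = r i) (M : Finset I) {w : F} (hw : w ≠ 0) :
    (∏ i ∈ M, (1 - 1 / (r i : ℂ))) * sieveWeight χ r M w =
      ∏ i ∈ M, if χ i w = 1 then (0 : ℂ) else 1 := by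
  have h1 : sieveWeight χ r M w =
      ∏ i ∈ M, if χ i w = 1 then 0 else (r i : ℂ) / ((r i : ℂ) - 1) := by
    have : ∀ j ∈ sieveExponents r M,
        (∏ i, sieveCoeff (r i) (j i)) * (∏ i, χ i ^ j i) w =
          ∏ i, sieveCoeff (r i) (j i) * χ i w ^ j i := by
      intro j _
      rw [prod_mulChar_pow_apply χ j hw, Finset.prod_mul_distrib]
    rw [sieveWeight, Finset.sum_congr rfl this, sieveExponents, ← Finset.prod_univ_sum
      (fun i => if i ∈ M then Finset.range (r i) else {0})
      (fun i k => sieveCoeff (r i) k * χ i w ^ k)]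
    have h2 : ∀ i, ∑ k ∈ (if i ∈ M then Finset.range (r i) else {0}),
        sieveCoeff (r i) k * χ i w ^ k = if i ∈ M then
          (if χ i w = 1 then 0 else (r i : ℂ) / ((r i : ℂ) - 1)) else 1 := by
      intro i
      by_cases hi : i ∈ M
      · rw [if_pos hi, if_pos hi, sum_sieveCoeff_mul_pow (hr i)]
        have h3 : (χ i ^ r i) w = 1 := by
          rw [← hχ i, pow_orderOf_eq_one, MulChar.one_apply hw.isUnit]
        rwa [MulChar.pow_apply' _ (by have := hr i; omega)] at h3
      · simp [hi, sieveCoeff]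
    simp_rw [h2]
    rw [Finset.prod_ite_mem, Finset.univ_inter]
  rw [h1, ← Finset.prod_mul_distrib]
  refine Finset.prod_congr rfl fun i _ => ?_
  split_ifs
  · rw [mul_zero]
  · have h4 : (r i : ℂ) ≠ 0 := by
      have := hr i
      exact_mod_cast (show r i ≠ 0 by omega)
    have h5 : (r i : ℂ) - 1 ≠ 0 := by
      have := hr i
      rw [sub_ne_zero]
      exact_mod_cast (show r i ≠ 1 by omega)
    field_simp

variable [Fintype F] {ι : Type*} [Fintype ι]

/-- The sieve weight on `M`, summed against `∑ C i ψ i` at squares. -/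
noncomputable def sieveSum (χ : I → MulChar F ℂ) (r : I → ℕ) (C : ι → ℂ)
    (ψ : ι → AddChar F ℂ) (M : Finset I) : ℂ :=
  ∑ w : F, sieveWeight χ r M w * ∑ a, C a * ψ a (w ^ 2)

theorem sieveSum_eq (χ : I → MulChar F ℂ) (r : I → ℕ) (C : ι → ℂ) (ψ : ι → AddChar F ℂ)
    (M : Finset I) :
    sieveSum χ r C ψ M = ∑ a, ∑ j ∈ sieveExponents r M, C a * (∏ i, sieveCoeff (r i) (j i)) *
      ∑ w : F, (∏ i, χ i ^ j i) w * ψ a (w ^ 2) := by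
  simp_rw [sieveSum, sieveWeight, Finset.mul_sum, Finset.sum_mul]
  rw [Finset.sum_comm]
  refine Finset.sum_congr rfl fun a _ => ?_
  rw [Finset.sum_comm]
  refine Finset.sum_congr rfl fun j _ => Finset.sum_congr rfl fun w _ => ?_
  ring

theorem norm_sieveSum_sub_card_le {χ : I → MulChar F ℂ} {r : I → ℕ}
    (hr : ∀ i, (r i).Prime) (hinj : Function.Injective r) (hχ : ∀ i, orderOf (χ i) = r i)
    {C : ι → ℂ} {ψ : ι → AddChar F ℂ} {a₀ : ι} (hC : C a₀ = 1) (hψ₀ : ψ a₀ = 1)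
    (hψ : ∀ a, a ≠ a₀ → C a ≠ 0 → ψ a ≠ 1) {B : ℝ} (hB : ∑ a, ‖C a‖ ≤ B) (M : Finset I) :
    ‖sieveSum χ r C ψ M - ((Fintype.card F : ℂ) - 1)‖ ≤
      2 ^ M.card * (B - 1) * (2 * √(Fintype.card F)) := by
  classical
  have hr1 : ∀ i, 1 < r i := fun i => (hr i).one_lt
  have hr0 : ∀ i, 0 < r i := fun i => (hr i).pos
  rw [sieveSum_eq, ← Finset.add_sum_erase _ _ (Finset.mem_univ a₀)]
  have hmain : ∑ j ∈ sieveExponents r M, C a₀ * (∏ i, sieveCoeff (r i) (j i)) *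
      ∑ w : F, (∏ i, χ i ^ j i) w * ψ a₀ (w ^ 2) = (Fintype.card F : ℂ) - 1 := by
    rw [Finset.sum_eq_single 0]
    · simp only [hC, hψ₀, Pi.zero_apply, pow_zero, Finset.prod_const_one, AddChar.one_apply,
        mul_one, MulChar.sum_one_eq_card_units, Fintype.card_units, sieveCoeff, if_true, one_mul]
      rw [Nat.cast_sub Fintype.card_pos, Nat.cast_one]
    · intro j hj hne
      simp only [hψ₀, AddChar.one_apply, mul_one]
      rw [MulChar.sum_eq_zero_of_ne_one, mul_zero]
      exact fun h => hne (eq_zero_of_prod_mulChar_pow_eq_one hr hinj hχ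
        (lt_of_mem_sieveExponents hr0 hj) h)
    · exact fun h => absurd (zero_mem_sieveExponents hr0 M) h
  rw [hmain, add_sub_cancel_left]
  have hE : ∑ a ∈ Finset.univ.erase a₀, ‖C a‖ ≤ B - 1 := by
    have := Finset.add_sum_erase Finset.univ (fun a => ‖C a‖) (Finset.mem_univ a₀)
    simp only [hC, norm_one] at this
    linarith
  calc _ ≤ ∑ a ∈ Finset.univ.erase a₀, ∑ j ∈ sieveExponents r M,
        ‖C a‖ * (∏ i, ‖sieveCoeff (r i) (j i)‖) * (2 * √(Fintype.card F)) := by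
        refine norm_sum_le_of_le _ fun a ha => norm_sum_le_of_le _ fun j _ => ?_
        rw [norm_mul, norm_mul, norm_prod]
        by_cases h0 : C a = 0
        · simp [h0]
        · gcongr
          exact norm_quadratic_sum_le _ (hψ a (Finset.ne_of_mem_erase ha) h0)
    _ = 2 ^ M.card * (∑ a ∈ Finset.univ.erase a₀, ‖C a‖) * (2 * √(Fintype.card F)) := by
        rw [← sum_prod_norm_sieveCoeff hr1 M, mul_comm (∑ j ∈ _, _), Finset.sum_mul_sum,
          Finset.sum_mul]
        exact Finset.sum_congr rfl fun a _ => (Finset.sum_mul _ _ _).symm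
    _ ≤ _ := by gcongr

theorem norm_sieveSum_insert_sub_le {χ : I → MulChar F ℂ} {r : I → ℕ}
    (hr : ∀ i, (r i).Prime) (hinj : Function.Injective r) (hχ : ∀ i, orderOf (χ i) = r i)
    {C : ι → ℂ} {ψ : ι → AddChar F ℂ} {B : ℝ} (hB : ∑ a, ‖C a‖ ≤ B)
    {M : Finset I} {i₀ : I} (hi₀ : i₀ ∉ M) :
    ‖sieveSum χ r C ψ (insert i₀ M) - sieveSum χ r C ψ M‖ ≤
      2 ^ M.card * B * (2 * √(Fintype.card F)) := by
  classical
  have hr1 : ∀ i, 1 < r i := fun i => (hr i).one_lt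
  have hr0 : ∀ i, 0 < r i := fun i => (hr i).pos
  have hsub := sieveExponents_mono hr0 (Finset.subset_insert i₀ M)
  have hweight : ∑ j ∈ sieveExponents r (insert i₀ M) \ sieveExponents r M,
      ∏ i, ‖sieveCoeff (r i) (j i)‖ = 2 ^ M.card := by
    have := Finset.sum_sdiff (f := fun j : I → ℕ => ∏ i, ‖sieveCoeff (r i) (j i)‖) hsub
    rw [sum_prod_norm_sieveCoeff hr1, sum_prod_norm_sieveCoeff hr1,
      Finset.card_insert_of_notMem hi₀, pow_succ] at this
    linarith
  rw [sieveSum_eq, sieveSum_eq, ← Finset.sum_sub_distrib]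
  calc _ ≤ ∑ a, ∑ j ∈ sieveExponents r (insert i₀ M) \ sieveExponents r M,
        ‖C a‖ * (∏ i, ‖sieveCoeff (r i) (j i)‖) * (2 * √(Fintype.card F)) := by
        refine norm_sum_le_of_le _ fun a _ => ?_
        rw [← Finset.sum_sdiff hsub, add_sub_cancel_right]
        refine norm_sum_le_of_le _ fun j hj => ?_
        rw [norm_mul, norm_mul, norm_prod]
        gcongr
        by_cases h0 : ψ a = 1
        · have hne : ∏ i, χ i ^ j i ≠ 1 := by
            intro h
            have := eq_zero_of_prod_mulChar_pow_eq_one hr hinj hχ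
              (lt_of_mem_sieveExponents hr0 (Finset.mem_sdiff.1 hj).1) h
            exact (Finset.mem_sdiff.1 hj).2 (this ▸ zero_mem_sieveExponents hr0 M)
          simp only [h0, AddChar.one_apply, mul_one]
          rw [MulChar.sum_eq_zero_of_ne_one hne, norm_zero]
          positivity
        · exact norm_quadratic_sum_le _ h0
    _ = 2 ^ M.card * (∑ a, ‖C a‖) * (2 * √(Fintype.card F)) := by
        rw [← hweight, mul_comm (∑ j ∈ _, _), Finset.sum_mul_sum, Finset.sum_mul]
        exact Finset.sum_congr rfl fun a _ => (Finset.sum_mul _ _ _).symm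
    _ ≤ _ := by gcongr

/-- The number of nonzero `w` with `χ i w ≠ 1` for `i ∈ M` whose square satisfies `G`, in terms
of character sums. -/
theorem card_eq_mul_sieveSum {χ : I → MulChar F ℂ} {r : I → ℕ} (hr : ∀ i, 1 < r i)
    (hχ : ∀ i, orderOf (χ i) = r i) {C : ι → ℂ} {ψ : ι → AddChar F ℂ}
    {G : F → Prop} {κ : ℝ}
    (hG : ∀ x, (G x → (κ : ℂ) * ∑ a, C a * ψ a x = 1) ∧
      (¬ G x → ∑ a, C a * ψ a x = 0))
    (M : Finset I) {S : Finset F}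
    (hS : ∀ w, w ∈ S ↔ w ≠ 0 ∧ (∀ i ∈ M, χ i w ≠ 1) ∧ G (w ^ 2)) :
    (S.card : ℝ) = κ * (∏ i ∈ M, (1 - 1 / (r i : ℝ))) * (sieveSum χ r C ψ M).re := by
  classical
  have key : (S.card : ℂ) =
      ((κ * ∏ i ∈ M, (1 - 1 / (r i : ℝ)) : ℝ) : ℂ) * sieveSum χ r C ψ M := by
    rw [sieveSum, Finset.mul_sum, Finset.cast_card, ← Finset.sum_subset S.subset_univ]
    · refine Finset.sum_congr rfl fun w hw => ?_
      obtain ⟨hw0, hM, hGw⟩ := (hS w).1 hw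
      have h1 := prod_mul_sieveWeight hr hχ M hw0
      rw [Finset.prod_congr rfl fun i hi => if_neg (hM i hi), Finset.prod_const_one] at h1
      have h2 := (hG (w ^ 2)).1 hGw
      push_cast
      linear_combination -h1 - h2 * ((∏ i ∈ M, (1 - 1 / (r i : ℂ))) * sieveWeight χ r M w)
    · intro w _ hw
      by_cases hw0 : w = 0
      · rw [hw0, sieveWeight_zero]
        ring
      by_cases hGw : G (w ^ 2)
      · obtain ⟨i, hi, hi1⟩ : ∃ i ∈ M, χ i w = 1 := by
          by_contra! hcon
          exact hw ((hS w).2 ⟨hw0, hcon, hGw⟩)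
        have h1 := prod_mul_sieveWeight hr hχ M hw0
        have h0 : ∏ i ∈ M, (if χ i w = 1 then (0 : ℂ) else 1) = 0 :=
          Finset.prod_eq_zero hi (by rw [if_pos hi1])
        rw [h0] at h1
        push_cast
        linear_combination h1 * κ * ∑ a, C a * ψ a (w ^ 2)
      · rw [(hG (w ^ 2)).2 hGw]
        ring
  have := congrArg Complex.re key
  rwa [Complex.natCast_re, Complex.re_ofReal_mul] at this

/-- The sieve: if the additive condition `G` has a normalised expansion `∑ C a ψ a` with
`∑ ‖C a‖ ≤ B`, then some `w` avoids all kernels `χ i w = 1` and has `G (w ^ 2)`. -/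
theorem exists_sieve {χ : I → MulChar F ℂ} {r : I → ℕ}
    (hr : ∀ i, (r i).Prime) (hinj : Function.Injective r) (hχ : ∀ i, orderOf (χ i) = r i)
    {C : ι → ℂ} {ψ : ι → AddChar F ℂ} {a₀ : ι} (hC : C a₀ = 1) (hψ₀ : ψ a₀ = 1)
    (hψ : ∀ a, a ≠ a₀ → C a ≠ 0 → ψ a ≠ 1) {B : ℝ} (hB : ∑ a, ‖C a‖ ≤ B)
    {G : F → Prop} {κ : ℝ} (hκ : 0 < κ)
    (hG : ∀ x, (G x → (κ : ℂ) * ∑ a, C a * ψ a x = 1) ∧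
      (¬ G x → ∑ a, C a * ψ a x = 0))
    (T : Finset I) {δ : ℝ} (hδ : δ = 1 - ∑ i ∈ T, 1 / (r i : ℝ)) (hδ0 : 0 < δ)
    (hineq : ((T.card : ℝ) - 1 + δ) * (2 ^ Tᶜ.card * B * (2 * √(Fintype.card F))) <
      δ * ((Fintype.card F : ℝ) - 1 - 2 ^ Tᶜ.card * (B - 1) * (2 * √(Fintype.card F)))) :
    ∃ w : F, w ≠ 0 ∧ (∀ i, χ i w ≠ 1) ∧ G (w ^ 2) := by
  classical
  by_contra! hcon
  have hr1 : ∀ i, 1 < r i := fun i => (hr i).one_lt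
  have hrpos : ∀ i, 0 < 1 - 1 / (r i : ℝ) := by
    intro i
    have : (1 : ℝ) < r i := by exact_mod_cast hr1 i
    rw [sub_pos, div_lt_one (by linarith)]
    exact this
  let S : Finset I → Finset F := fun M =>
    Finset.univ.filter fun w => w ≠ 0 ∧ (∀ i ∈ M, χ i w ≠ 1) ∧ G (w ^ 2)
  have hcard : ∀ M, ((S M).card : ℝ) =
      κ * (∏ i ∈ M, (1 - 1 / (r i : ℝ))) * (sieveSum χ r C ψ M).re := fun M =>
    card_eq_mul_sieveSum hr1 hχ hG M (fun w => by simp [S])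
  set θ := ∏ i ∈ Tᶜ, (1 - 1 / (r i : ℝ)) with hθ
  have hθ0 : 0 < θ := Finset.prod_pos fun i _ => hrpos i
  set R := (sieveSum χ r C ψ Tᶜ).re with hR
  set E := 2 ^ Tᶜ.card * B * (2 * √(Fintype.card F)) with hE
  have hcount : ∑ i ∈ T, ((S (insert i Tᶜ)).card : ℝ) ≤ ((T.card : ℝ) - 1) * (S Tᶜ).card := by
    have h1 : ∀ i ∈ T, ((S (insert i Tᶜ)).card : ℝ) =
        ∑ w ∈ S Tᶜ, if χ i w ≠ 1 then (1 : ℝ) else 0 := by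
      intro i _
      rw [← Finset.sum_filter, ← Finset.cast_card]
      congr 2
      ext w
      simp only [S, Finset.mem_filter, Finset.mem_univ, true_and, Finset.forall_mem_insert]
      tauto
    rw [Finset.sum_congr rfl h1, Finset.sum_comm, mul_comm, ← nsmul_eq_mul]
    refine Finset.sum_le_card_nsmul _ _ _ fun w hw => ?_
    obtain ⟨hw0, hM, hGw⟩ := (Finset.mem_filter.1 hw).2
    obtain ⟨i, hiT, hi1⟩ : ∃ i ∈ T, χ i w = 1 := by
      by_contra! hT
      refine hcon w hw0 (fun i => ?_) hGw
      by_cases hi : i ∈ T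
      · exact hT i hi
      · exact hM i (Finset.mem_compl.2 hi)
    rw [← Finset.add_sum_erase _ _ hiT, if_neg (not_not.2 hi1), zero_add]
    calc _ ≤ ∑ k ∈ T.erase i, (1 : ℝ) := Finset.sum_le_sum fun k _ => by split_ifs <;> norm_num
      _ = (T.card : ℝ) - 1 := by
        rw [Finset.sum_const, Finset.card_erase_of_mem hiT, nsmul_eq_mul, mul_one,
          Nat.cast_sub (Finset.card_pos.2 ⟨i, hiT⟩), Nat.cast_one]
  have hlow : ∀ i ∈ T, κ * θ * ((1 - 1 / (r i : ℝ)) * (R - E)) ≤ (S (insert i Tᶜ)).card := by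
    intro i hi
    have hi' : i ∉ Tᶜ := by simpa using hi
    rw [hcard, Finset.prod_insert hi', ← hθ]
    have h1 := norm_sieveSum_insert_sub_le (ψ := ψ) hr hinj hχ hB hi'
    have h2 := (Complex.abs_re_le_norm _).trans h1
    rw [Complex.sub_re, abs_le] at h2
    have h3 : R - E ≤ (sieveSum χ r C ψ (insert i Tᶜ)).re := by linarith [h2.1]
    have h4 := mul_le_mul_of_nonneg_left h3
      (mul_pos (mul_pos hκ hθ0) (hrpos i)).le
    linarith
  have hsum := (Finset.sum_le_sum hlow).trans hcount
  rw [hcard, ← hθ, ← hR, ← Finset.mul_sum, ← Finset.sum_mul, Finset.sum_sub_distrib,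
    Finset.sum_const, nsmul_eq_mul, mul_one] at hsum
  have hratio : ((T.card : ℝ) - ∑ i ∈ T, 1 / (r i : ℝ)) * (R - E) ≤ ((T.card : ℝ) - 1) * R := by
    refine le_of_mul_le_mul_left ?_ (mul_pos hκ hθ0)
    linarith
  have hmain := (Complex.abs_re_le_norm _).trans
    (norm_sieveSum_sub_card_le hr hinj hχ hC hψ₀ hψ hB Tᶜ)
  rw [Complex.sub_re, Complex.sub_re, Complex.natCast_re, Complex.one_re, abs_le] at hmain
  have hscaled := mul_le_mul_of_nonneg_left hmain.1 hδ0.le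
  rw [show ∑ i ∈ T, 1 / (r i : ℝ) = 1 - δ by linarith] at hratio
  linarith

end Sieve

section AdditiveExpansion

variable {A B D J : Type*} [AddCommGroup A] [AddCommGroup B] [AddCommGroup D] [Fintype J]

/-- The character `β (tr x) ∏ φ g (π g x)`. -/
noncomputable def addSieveChar (tr : A →+ B) (π : J → A →+ D)
    (a : AddChar B ℂ × (J → AddChar D ℂ)) : AddChar A ℂ :=
  a.1.compAddMonoidHom tr * ∏ g, (a.2 g).compAddMonoidHom (π g)

theorem addSieveChar_apply (tr : A →+ B) (π : J → A →+ D)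
    (a : AddChar B ℂ × (J → AddChar D ℂ)) (x : A) :
    addSieveChar tr π a x = a.1 (tr x) * ∏ g, a.2 g (π g x) := by
  simp [addSieveChar, AddChar.mul_apply, AddChar.prod_apply]

variable [Fintype D]

open Classical in
/-- The coefficients of the expansion of the indicator of `π x ≠ 0`, for `x ∈ V`, in the
characters `φ (π x)`, normalised to have constant coefficient `1`. -/
noncomputable def addSieveCoeff (V : Set A) (π : A →+ D) (φ : AddChar D ℂ) : ℂ :=
  if φ = 1 then 1 else if ∃ x ∈ V, φ (π x) ≠ 1 then
    -1 / ((Finset.univ.filter fun φ : AddChar D ℂ => ∃ x ∈ V, φ (π x) ≠ 1).card : ℂ) else 0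

theorem addSieveCoeff_one (V : Set A) (π : A →+ D) : addSieveCoeff V π 1 = 1 := if_pos rfl

theorem exists_ne_one_of_addSieveCoeff_ne_zero {V : Set A} {π : A →+ D} {φ : AddChar D ℂ}
    (hφ : φ ≠ 1) (h : addSieveCoeff V π φ ≠ 0) : ∃ x ∈ V, φ (π x) ≠ 1 := by
  classical
  by_contra hcon
  exact h (by rw [addSieveCoeff, if_neg hφ, if_neg hcon])

theorem sum_addSieveCoeff_mul {V : Set A} {π : A →+ D} {R : Type*} [Semiring R]
    (f : ℂ → R) (hf : f 0 = 0) (g : AddChar D ℂ → R) :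
    ∃ S : Finset (AddChar D ℂ), (∀ φ, φ ∈ S ↔ ∃ x ∈ V, φ (π x) ≠ 1) ∧
      ∑ φ, f (addSieveCoeff V π φ) * g φ = f 1 * g 1 + f (-1 / (S.card : ℂ)) * ∑ φ ∈ S, g φ := by
  classical
  set S : Finset (AddChar D ℂ) := Finset.univ.filter fun φ => ∃ x ∈ V, φ (π x) ≠ 1 with hS
  have hmem : ∀ φ, φ ∈ S ↔ ∃ x ∈ V, φ (π x) ≠ 1 := by simp [hS]
  have h1 : (1 : AddChar D ℂ) ∉ S := by simp [hmem]
  refine ⟨S, hmem, ?_⟩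
  rw [← Finset.sum_subset (Finset.subset_univ (insert 1 S)), Finset.sum_insert h1,
    addSieveCoeff_one, Finset.mul_sum]
  · congr 1
    refine Finset.sum_congr rfl fun φ hφ => ?_
    rw [addSieveCoeff, if_neg (ne_of_mem_of_not_mem hφ h1), if_pos ((hmem φ).1 hφ), ← hS]
  · intro φ _ hφ
    rw [Finset.mem_insert, not_or, hmem] at hφ
    rw [addSieveCoeff, if_neg hφ.1, if_neg hφ.2, hf, zero_mul]

theorem exists_char_ne_one {V : Set A} {π : A →+ D} (hπ : ∃ x ∈ V, π x ≠ 0) :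
    ∃ φ : AddChar D ℂ, ∃ x ∈ V, φ (π x) ≠ 1 := by
  obtain ⟨x, hx, hπx⟩ := hπ
  obtain ⟨φ, hφ⟩ := AddChar.exists_apply_ne_zero.2 hπx
  exact ⟨φ, x, hx, hφ⟩

theorem sum_norm_addSieveCoeff {V : Set A} {π : A →+ D} (hπ : ∃ x ∈ V, π x ≠ 0) :
    ∑ φ, ‖addSieveCoeff V π φ‖ = 2 := by
  obtain ⟨S, hS, h⟩ := sum_addSieveCoeff_mul (V := V) (π := π) (fun z => ‖z‖) norm_zero
    (fun _ => 1)
  obtain ⟨φ, hφ⟩ := exists_char_ne_one hπ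
  have hS0 : (S.card : ℝ) ≠ 0 := by
    exact_mod_cast (Finset.card_pos.2 ⟨φ, (hS φ).2 hφ⟩).ne'
  simp only [mul_one] at h
  rw [h]
  simp [hS0]
  norm_num

theorem exists_sum_addSieveCoeff_mul_apply {V : Set A} {π : A →+ D} (hπ : ∃ x ∈ V, π x ≠ 0) :
    ∃ κ : ℝ, 0 < κ ∧ ∀ x ∈ V,
      (π x ≠ 0 → (κ : ℂ) * ∑ φ, addSieveCoeff V π φ * φ (π x) = 1) ∧
      (π x = 0 → ∑ φ, addSieveCoeff V π φ * φ (π x) = 0) := by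
  classical
  obtain ⟨φ₀, hφ₀⟩ := exists_char_ne_one hπ
  set N := (Finset.univ.filter fun φ : AddChar D ℂ => ∃ x ∈ V, φ (π x) ≠ 1).card with hN
  have hN0 : 0 < N := Finset.card_pos.2 ⟨φ₀, by simpa using hφ₀⟩
  have hD : 0 < Fintype.card D := Fintype.card_pos
  refine ⟨N / Fintype.card D, by positivity, fun x hx => ?_⟩
  obtain ⟨S, hS, h⟩ := sum_addSieveCoeff_mul (V := V) (π := π) id rfl (fun φ => φ (π x))
  have hSN : S.card = N := by
    rw [hN]
    congr 1
    ext φ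
    simp [hS]
  have hcompl : ∑ φ ∈ Sᶜ, φ (π x) = (Fintype.card D : ℂ) - N := by
    rw [Finset.sum_congr rfl (g := fun _ => (1 : ℂ)), Finset.sum_const, Finset.card_compl, hSN,
      AddChar.card_eq, nsmul_eq_mul, mul_one, Nat.cast_sub]
    · rw [← hSN, ← AddChar.card_eq (α := D)]
      exact Finset.card_le_univ S
    · intro φ hφ
      by_contra hne
      exact (Finset.mem_compl.1 hφ) ((hS φ).2 ⟨x, hx, hne⟩)
  have hsum := Finset.sum_add_sum_compl S fun φ : AddChar D ℂ => φ (π x)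
  rw [hcompl, AddChar.sum_apply_eq_ite] at hsum
  simp only [id, hSN, AddChar.one_apply, mul_one] at h
  have hN' : (N : ℂ) ≠ 0 := by exact_mod_cast hN0.ne'
  have hD' : (Fintype.card D : ℂ) ≠ 0 := by exact_mod_cast hD.ne'
  rw [h]
  constructor
  · intro hne
    rw [if_neg hne] at hsum
    rw [eq_neg_of_add_eq_zero_left hsum]
    push_cast
    field_simp
    ring
  · intro heq
    rw [if_pos heq] at hsum
    rw [show ∑ φ ∈ S, φ (π x) = (N : ℂ) by linear_combination hsum]
    field_simp
    ring

theorem addSieveChar_ne_one [DecidableEq J] {tr : A →+ B} (htr : Function.Surjective tr)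
    {π : J → A →+ D}
    (hind : ∀ g x, tr x = 0 → ∃ y, tr y = 0 ∧ π g y = π g x ∧ ∀ h, h ≠ g → π h y = 0)
    {a : AddChar B ℂ × (J → AddChar D ℂ)} (ha : a ≠ 1)
    (hC : ∏ g, addSieveCoeff {x | tr x = 0} (π g) (a.2 g) ≠ 0) :
    addSieveChar tr π a ≠ 1 := by
  rw [AddChar.ne_one_iff]
  by_cases h2 : a.2 = 1
  · have h1 : a.1 ≠ 1 := fun h => ha (Prod.ext h h2)
    obtain ⟨b, hb⟩ := AddChar.ne_one_iff.1 h1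
    obtain ⟨x, rfl⟩ := htr b
    refine ⟨x, ?_⟩
    simpa [addSieveChar_apply, h2] using hb
  · obtain ⟨g, hg⟩ := Function.ne_iff.1 h2
    obtain ⟨x, hx, hne⟩ := exists_ne_one_of_addSieveCoeff_ne_zero hg
      (Finset.prod_ne_zero_iff.1 hC g (Finset.mem_univ g))
    obtain ⟨y, hy, hyg, hyh⟩ := hind g x hx
    refine ⟨y, ?_⟩
    rw [addSieveChar_apply, hy, AddChar.map_zero_eq_one, one_mul,
      Finset.prod_eq_single g (fun h _ hh => by rw [hyh h hh, AddChar.map_zero_eq_one])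
        (fun h => absurd (Finset.mem_univ g) h), hyg]
    exact hne

variable [Fintype B]

theorem sum_norm_addSieveCoeff_prod [DecidableEq J] {tr : A →+ B} {π : J → A →+ D}
    (hπ : ∀ g, ∃ x, tr x = 0 ∧ π g x ≠ 0) :
    ∑ a : AddChar B ℂ × (J → AddChar D ℂ),
      ‖∏ g, addSieveCoeff {x | tr x = 0} (π g) (a.2 g)‖ =
        Fintype.card B * 2 ^ Fintype.card J := by
  simp_rw [norm_prod]
  rw [Fintype.sum_prod_type]
  dsimp only
  rw [Finset.sum_const, Finset.card_univ, AddChar.card_eq, nsmul_eq_mul,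
    ← Fintype.piFinset_univ, ← Finset.prod_univ_sum (fun _ => Finset.univ)
      (fun g φ => ‖addSieveCoeff {x | tr x = 0} (π g) φ‖),
    Finset.prod_congr rfl fun g _ => sum_norm_addSieveCoeff (V := {x | tr x = 0}) (hπ g),
    Finset.prod_const,
    Finset.card_univ]

theorem exists_sum_addSieveChar [DecidableEq J] {tr : A →+ B} {π : J → A →+ D}
    (hπ : ∀ g, ∃ x, tr x = 0 ∧ π g x ≠ 0) :
    ∃ κ : ℝ, 0 < κ ∧ ∀ x,
      ((tr x = 0 ∧ ∀ g, π g x ≠ 0) → (κ : ℂ) * ∑ a : AddChar B ℂ × (J → AddChar D ℂ),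
        (∏ g, addSieveCoeff {x | tr x = 0} (π g) (a.2 g)) * addSieveChar tr π a x = 1) ∧
      (¬ (tr x = 0 ∧ ∀ g, π g x ≠ 0) → ∑ a : AddChar B ℂ × (J → AddChar D ℂ),
        (∏ g, addSieveCoeff {x | tr x = 0} (π g) (a.2 g)) * addSieveChar tr π a x = 0) := by
  classical
  choose κ hκ0 hκ using fun g => exists_sum_addSieveCoeff_mul_apply
    (V := {x | tr x = 0}) (π := π g) (hπ g)
  have hB : (0 : ℝ) < Fintype.card B := by exact_mod_cast Fintype.card_pos
  have hB' : (Fintype.card B : ℂ) ≠ 0 := by exact_mod_cast hB.ne'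
  have hfac : ∀ x, ∑ a : AddChar B ℂ × (J → AddChar D ℂ),
      (∏ g, addSieveCoeff {x | tr x = 0} (π g) (a.2 g)) * addSieveChar tr π a x =
      (∑ β : AddChar B ℂ, β (tr x)) *
        ∏ g, ∑ φ, addSieveCoeff {x | tr x = 0} (π g) φ * φ (π g x) := by
    intro x
    rw [Finset.prod_univ_sum, Fintype.piFinset_univ, Finset.sum_mul_sum, Fintype.sum_prod_type]
    refine Finset.sum_congr rfl fun β _ => Finset.sum_congr rfl fun φ _ => ?_
    rw [addSieveChar_apply, Finset.prod_mul_distrib]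
    ring
  refine ⟨1 / Fintype.card B * ∏ g, κ g,
    mul_pos (by positivity) (Finset.prod_pos fun g _ => hκ0 g), fun x => ⟨?_, ?_⟩⟩
  · rintro ⟨h0, hne⟩
    rw [hfac, AddChar.sum_apply_eq_ite, if_pos h0]
    push_cast
    have h1 : (∏ g, (κ g : ℂ)) *
        ∏ g, ∑ φ, addSieveCoeff {x | tr x = 0} (π g) φ * φ (π g x) = 1 := by
      rw [← Finset.prod_mul_distrib]
      exact Finset.prod_eq_one fun g _ => (hκ g x h0).1 (hne g)
    calc _ = (1 / (Fintype.card B : ℂ) * Fintype.card B) * ((∏ g, (κ g : ℂ)) *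
        ∏ g, ∑ φ, addSieveCoeff {x | tr x = 0} (π g) φ * φ (π g x)) := by ring
      _ = 1 := by rw [h1, one_div_mul_cancel hB', mul_one]
  · intro hcon
    rw [hfac, AddChar.sum_apply_eq_ite]
    by_cases h0 : tr x = 0
    · obtain ⟨g, hg⟩ : ∃ g, π g x = 0 := by
        by_contra! h
        exact hcon ⟨h0, h⟩
      rw [Finset.prod_eq_zero (Finset.mem_univ g) ((hκ g x h0).2 hg), mul_zero]
    · rw [if_neg h0, zero_mul]

end AdditiveExpansion

section FrobeniusModule

theorem isCoprime_of_monic_irreducible {K : Type*} [Field K] {f g : K[X]} (hf : Irreducible f)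
    (hg : Irreducible g) (hfm : f.Monic) (hgm : g.Monic) (hne : f ≠ g) : IsCoprime f g :=
  hf.coprime_iff_not_dvd.2 fun h =>
    hne (eq_of_monic_of_associated hfm hgm (hf.associated_of_dvd hg h))

theorem aeval_mul_apply {K M : Type*} [Field K] [AddCommGroup M] [Module K M]
    (σ : Module.End K M) (f g : K[X]) (x : M) :
    aeval σ (f * g) x = aeval σ f (aeval σ g x) := by
  rw [map_mul, Module.End.mul_apply]

/-- If `F` annihilates `x`, but no `F / g` with `g` a monic irreducible factor of `F` does, then
`F` generates the annihilator of `x`. -/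
theorem dvd_of_aeval_apply_eq_zero {K M : Type*} [Field K] [AddCommGroup M] [Module K M]
    {σ : Module.End K M} {F : K[X]} (hF : F ≠ 0) {x : M} (hx : aeval σ F x = 0)
    (hmin : ∀ g : K[X], Irreducible g → g.Monic → g ∣ F → aeval σ (F / g) x ≠ 0)
    {P : K[X]} (hP : aeval σ P x = 0) : F ∣ P := by
  classical
  set G := EuclideanDomain.gcd F P with hG
  have hGx : aeval σ G x = 0 := by
    rw [hG, EuclideanDomain.gcd_eq_gcd_ab, map_add, LinearMap.add_apply, mul_comm F, mul_comm P,
      aeval_mul_apply, aeval_mul_apply, hx, hP, map_zero, map_zero, add_zero]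
  obtain ⟨H, hH⟩ := EuclideanDomain.gcd_dvd_left F P
  rw [← hG] at hH
  by_cases hu : IsUnit H
  · have : F ∣ G := by
      rw [hH]
      exact hu.mul_right_dvd.2 dvd_rfl
    exact this.trans (EuclideanDomain.gcd_dvd_right F P)
  · have hH0 : H ≠ 0 := by
      rintro rfl
      exact hF (by rw [hH, mul_zero])
    obtain ⟨g, hgm, hgi, H', rfl⟩ := Polynomial.exists_monic_irreducible_factor H hu
    have hg0 : g ≠ 0 := hgi.ne_zero
    refine absurd ?_ (hmin g hgi hgm (hH ▸ Dvd.dvd.mul_left (dvd_mul_right g H') G))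
    have : F / g = H' * G := by
      rw [hH, mul_left_comm, mul_div_cancel_left₀ _ hg0, mul_comm]
    rw [this, aeval_mul_apply, hGx, map_zero]

variable (K L : Type*) [Field K] [Field L] [Algebra K L]

/-- The cofactor of `X - 1` in `X ^ n - 1`, where `n = [L : K]`. -/
noncomputable abbrev tracePoly : K[X] := ∑ i ∈ Finset.range (Module.finrank K L), X ^ i

theorem tracePoly_mul : tracePoly K L * (X - 1) = X ^ Module.finrank K L - 1 :=
  geom_sum_mul _ _

theorem tracePoly_monic [FiniteDimensional K L] : (tracePoly K L).Monic :=
  monic_geom_sum_X (Module.finrank_pos).ne'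

theorem natDegree_tracePoly [FiniteDimensional K L] :
    (tracePoly K L).natDegree = Module.finrank K L - 1 := by
  have h1 : (X - 1 : K[X]).Monic := by simpa using monic_X_sub_C (1 : K)
  have h2 : (X - 1 : K[X]).natDegree = 1 := by simpa using natDegree_X_sub_C (1 : K)
  have h := congrArg natDegree (tracePoly_mul K L)
  rw [(tracePoly_monic K L).natDegree_mul h1, h2] at h
  have h3 : (X ^ Module.finrank K L - 1 : K[X]).natDegree = Module.finrank K L := by
    simpa using natDegree_X_pow_sub_C (n := Module.finrank K L) (r := (1 : K))
  omega

variable [Fintype K]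

/-- The Frobenius `x ↦ x ^ #K` as a `K`-linear endomorphism. -/
noncomputable abbrev frobeniusEnd : Module.End K L :=
  (FiniteField.frobeniusAlgHom K L).toLinearMap

variable {L} in
theorem frobeniusEnd_pow_apply (i : ℕ) (x : L) :
    (frobeniusEnd K L ^ i) x = x ^ Fintype.card K ^ i := by
  induction i with
  | zero => simp
  | succ i ih =>
    rw [pow_succ', Module.End.mul_apply, ih, pow_succ, pow_mul]
    rfl

variable [Fintype L]

variable {L} in
theorem aeval_tracePoly_apply (x : L) :
    aeval (frobeniusEnd K L) (tracePoly K L) x = algebraMap K L (Algebra.trace K L x) := by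
  rw [FiniteField.algebraMap_trace_eq_sum_pow, map_sum, LinearMap.sum_apply]
  refine Finset.sum_congr rfl fun i _ => ?_
  rw [map_pow, aeval_X, frobeniusEnd_pow_apply, Fintype.card_eq_nat_card]

variable {L} in
theorem trace_eq_zero_iff_aeval_tracePoly (x : L) :
    Algebra.trace K L x = 0 ↔ aeval (frobeniusEnd K L) (tracePoly K L) x = 0 := by
  rw [aeval_tracePoly_apply, FaithfulSMul.algebraMap_eq_zero_iff]

variable {K L} in
/-- An element whose annihilator is generated by `tracePoly` is `1`-normal. -/
theorem finrank_conjSpan_of_trace_eq_zero {x : L} (hx : Algebra.trace K L x = 0)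
    (hmin : ∀ g : K[X], Irreducible g → g.Monic → g ∣ tracePoly K L →
      aeval (frobeniusEnd K L) (tracePoly K L / g) x ≠ 0) :
    Module.finrank K (conjSpan K (Fintype.card K) (Module.finrank K L) x) =
      Module.finrank K L - 1 := by
  obtain ⟨m, hm⟩ : ∃ m, Module.finrank K L = m + 1 :=
    ⟨Module.finrank K L - 1, by have := Module.finrank_pos (R := K) (M := L); omega⟩
  set v : Fin m → L := fun i => x ^ Fintype.card K ^ (i : ℕ) with hv
  have hli : LinearIndependent K v := by
    rw [Fintype.linearIndependent_iff]
    intro c hc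
    set P : K[X] := ∑ i : Fin m, C (c i) * X ^ (i : ℕ) with hP
    have hPx : aeval (frobeniusEnd K L) P x = 0 := by
      rw [← hc, hP, map_sum, LinearMap.sum_apply]
      refine Finset.sum_congr rfl fun i _ => ?_
      rw [aeval_mul_apply, map_pow, aeval_X, aeval_C, frobeniusEnd_pow_apply]
      rfl
    have hdvd := dvd_of_aeval_apply_eq_zero (tracePoly_monic K L).ne_zero
      ((trace_eq_zero_iff_aeval_tracePoly K x).1 hx) hmin hPx
    have hP0 : P = 0 := by
      refine eq_zero_of_dvd_of_degree_lt hdvd ?_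
      rw [degree_eq_natDegree (tracePoly_monic K L).ne_zero, natDegree_tracePoly, hm,
        Nat.add_sub_cancel]
      exact degree_sum_fin_lt c
    intro i
    have := congrArg (fun Q => coeff Q (i : ℕ)) hP0
    simpa [hP, finsetSum_coeff, coeff_C_mul, coeff_X_pow, Fin.val_inj] using this
  have hspan : conjSpan K (Fintype.card K) (Module.finrank K L) x =
      Submodule.span K (Set.range v) := by
    refine le_antisymm (Submodule.span_le.2 ?_) (Submodule.span_mono ?_)
    · rintro _ ⟨⟨i, hi⟩, rfl⟩
      by_cases him : i < m
      · exact Submodule.subset_span ⟨⟨i, him⟩, rfl⟩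
      · have himm : i = m := by omega
        have hsum := FiniteField.algebraMap_trace_eq_sum_pow K L x
        rw [hx, map_zero, hm, Finset.sum_range_succ, ← Fintype.card_eq_nat_card] at hsum
        change x ^ Fintype.card K ^ i ∈ Submodule.span K (Set.range v)
        rw [himm, eq_neg_of_add_eq_zero_right hsum.symm]
        exact Submodule.neg_mem _ (Submodule.sum_mem _ fun k hk =>
          Submodule.subset_span ⟨⟨k, Finset.mem_range.1 hk⟩, rfl⟩)
    · rintro _ ⟨i, rfl⟩
      exact ⟨⟨i, by omega⟩, rfl⟩
  rw [hspan, finrank_span_eq_card hli, Fintype.card_fin, hm, Nat.add_sub_cancel]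

variable {K} in
theorem exists_aeval_tracePoly_div_ne_zero {g : K[X]} (hg : Irreducible g)
    (hdvd : g ∣ tracePoly K L) :
    ∃ x : L, Algebra.trace K L x = 0 ∧
      aeval (frobeniusEnd K L) (tracePoly K L / g) x ≠ 0 := by
  by_contra! hcon
  have hann : aeval (frobeniusEnd K L) (tracePoly K L / g * (X - 1)) = 0 := by
    ext y
    rw [aeval_mul_apply, LinearMap.zero_apply]
    refine hcon _ ?_
    rw [trace_eq_zero_iff_aeval_tracePoly, ← aeval_mul_apply, tracePoly_mul,
      ← FiniteField.minpoly_frobeniusAlgHom, minpoly.aeval, LinearMap.zero_apply]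
  have hmul := EuclideanDomain.mul_div_cancel' hg.ne_zero hdvd
  have h1 := minpoly.dvd K _ hann
  rw [FiniteField.minpoly_frobeniusAlgHom, ← tracePoly_mul] at h1
  have hX : (X - 1 : K[X]) ≠ 0 := by simpa using X_sub_C_ne_zero (1 : K)
  have h2 := (mul_dvd_mul_iff_right hX).1 h1
  obtain ⟨c, hc⟩ := h2
  refine hg.not_isUnit (IsUnit.of_mul_eq_one c ?_)
  refine mul_left_cancel₀ (tracePoly_monic K L).ne_zero ?_
  linear_combination hmul - g * hc

variable {K L} in
theorem exists_aeval_tracePoly_div_separate {J : Finset K[X]}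
    (hJ : ∀ g ∈ J, Irreducible g ∧ g.Monic ∧ g ∣ tracePoly K L) {g : K[X]} (hg : g ∈ J)
    {x : L} (hx : Algebra.trace K L x = 0) :
    ∃ y : L, Algebra.trace K L y = 0 ∧
      aeval (frobeniusEnd K L) (tracePoly K L / g) y =
        aeval (frobeniusEnd K L) (tracePoly K L / g) x ∧
      ∀ h ∈ J, h ≠ g → aeval (frobeniusEnd K L) (tracePoly K L / h) y = 0 := by
  classical
  have hcop : IsCoprime g (∏ h ∈ J.erase g, h) := by
    refine IsCoprime.prod_right fun h hh => ?_
    have hhJ := Finset.mem_of_mem_erase hh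
    exact isCoprime_of_monic_irreducible (hJ g hg).1 (hJ h hhJ).1 (hJ g hg).2.1 (hJ h hhJ).2.1
      (Finset.ne_of_mem_erase hh).symm
  obtain ⟨a, b, hab⟩ := hcop
  rw [trace_eq_zero_iff_aeval_tracePoly] at hx
  have hkill : ∀ f : K[X], aeval (frobeniusEnd K L) (f * tracePoly K L) x = 0 := fun f => by
    rw [aeval_mul_apply, hx, map_zero]
  have hdiv : ∀ h ∈ J, h * (tracePoly K L / h) = tracePoly K L := fun h hh =>
    EuclideanDomain.mul_div_cancel' (hJ h hh).1.ne_zero (hJ h hh).2.2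
  refine ⟨aeval (frobeniusEnd K L) (b * ∏ h ∈ J.erase g, h) x, ?_, ?_, ?_⟩
  · rw [trace_eq_zero_iff_aeval_tracePoly, ← aeval_mul_apply, mul_comm]
    exact hkill _
  · rw [← aeval_mul_apply, ← sub_eq_zero, ← LinearMap.sub_apply, ← map_sub]
    convert hkill (-a) using 3
    linear_combination (tracePoly K L / g) * hab - a * hdiv g hg
  · intro h hh hne
    obtain ⟨c, hc⟩ := Finset.dvd_prod_of_mem (fun f : K[X] => f)
      (Finset.mem_erase.2 ⟨hne, hh⟩)
    rw [← aeval_mul_apply]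
    convert hkill (b * c) using 3
    rw [hc]
    linear_combination (b * c) * hdiv h hh

end FrobeniusModule

section FactorCount

theorem two_pow_card_le_Wpoly {K : Type*} [Field K] [Finite K] {f : K[X]} (hf : f ≠ 0)
    {I : Finset K[X]} (hI : ∀ g ∈ I, Irreducible g ∧ g.Monic ∧ g ∣ f) :
    2 ^ I.card ≤ Wpoly f := by
  classical
  have hpair : ∀ s ⊆ I, (s : Set K[X]).Pairwise (Function.onFun IsCoprime fun g => g) :=
    fun s hs g hg h hh hne => isCoprime_of_monic_irreducible (hI g (hs hg)).1 (hI h (hs hh)).1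
      (hI g (hs hg)).2.1 (hI h (hs hh)).2.1 hne
  have hfin : {d : K[X] | d.Monic ∧ Squarefree d ∧ d ∣ f}.Finite := by
    have : Finite (degreeLT K (f.natDegree + 1)) :=
      Finite.of_equiv _ (degreeLTEquiv K (f.natDegree + 1)).symm.toEquiv
    refine Set.Finite.subset (Set.toFinite (degreeLT K (f.natDegree + 1) : Set K[X])) ?_
    rintro d ⟨hd, -, hdf⟩
    rw [SetLike.mem_coe, mem_degreeLT, degree_eq_natDegree hd.ne_zero, Nat.cast_lt]
    exact Nat.lt_succ_of_le (natDegree_le_of_dvd hdf hf)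
  rw [← Finset.card_powerset, ← Set.ncard_coe_finset, Wpoly]
  refine Set.ncard_le_ncard_of_injOn (fun s => ∏ g ∈ s, g) ?_ ?_ hfin
  · intro s hs
    have hsI := Finset.mem_powerset.1 hs
    exact ⟨monic_prod_of_monic _ _ fun g hg => (hI g (hsI hg)).2.1,
      Finset.squarefree_prod_of_pairwise_isCoprime
        (fun g hg h hh hne => (hpair s hsI hg hh hne).isRelPrime)
        fun g hg => (hI g (hsI hg)).1.squarefree,
      Finset.prod_dvd_of_coprime (hpair s hsI) fun g hg => (hI g (hsI hg)).2.2⟩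
  · have hmem : ∀ s ⊆ I, ∀ g ∈ I, g ∣ ∏ h ∈ s, h → g ∈ s := by
      intro s hs g hg hdvd
      obtain ⟨h, hh, hgh⟩ := ((hI g hg).1.prime.dvd_finsetProd_iff _).1 hdvd
      have := (hI g hg).1.associated_of_dvd (hI h (hs hh)).1 hgh
      rwa [eq_of_monic_of_associated (hI g hg).2.1 (hI h (hs hh)).2.1 this]
    intro s hs t ht hst
    have hs' := Finset.mem_powerset.1 hs
    have ht' := Finset.mem_powerset.1 ht
    dsimp only at hst
    refine Finset.Subset.antisymm (fun g hg => ?_) fun g hg => ?_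
    · exact hmem t ht' g (hs' hg) (hst ▸ Finset.dvd_prod_of_mem (fun f : K[X] => f) hg)
    · exact hmem s hs' g (ht' hg) (hst ▸ Finset.dvd_prod_of_mem (fun f : K[X] => f) hg)

/-- Comparison of the number of irreducible factors of `1 + X + ⋯ + X ^ (n - 1)` with
`W (X ^ u - 1)`, where `n = p ^ k u`. -/
theorem two_mul_card_mul_two_pow_le {K : Type*} [Field K] [Fintype K] {p k u : ℕ}
    [Fact p.Prime] [CharP K p] (hu : Nat.gcd u p = 1) {J : Finset K[X]}
    (hJ : ∀ g ∈ J, Irreducible g ∧ g.Monic ∧ g ∣ ∑ i ∈ Finset.range (p ^ k * u), X ^ i) :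
    2 * (Fintype.card K * 2 ^ J.card) ≤
      Fintype.card K ^ p ^ k * Wpoly ((X : K[X]) ^ u - 1) := by
  classical
  have hp : p.Prime := Fact.out
  have hu0 : (u : K) ≠ 0 := by
    rw [Ne, CharP.cast_eq_zero_iff K p]
    intro h
    rw [Nat.gcd_eq_right h] at hu
    exact hp.one_lt.ne' hu
  have hsep : ((X : K[X]) ^ u - 1).Separable := X_pow_sub_one_separable_iff.2 hu0
  have hne : (X : K[X]) ^ u - 1 ≠ 0 := hsep.ne_zero
  have hJu : ∀ g ∈ J, Irreducible g ∧ g.Monic ∧ g ∣ (X : K[X]) ^ u - 1 := by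
    intro g hg
    obtain ⟨hgi, hgm, hgd⟩ := hJ g hg
    refine ⟨hgi, hgm, hgi.prime.dvd_of_dvd_pow (n := p ^ k) ?_⟩
    rw [sub_pow_char_pow, one_pow, ← pow_mul, mul_comm u, ← geom_sum_mul]
    exact Dvd.dvd.mul_right hgd _
  have hK2 : 2 ≤ Fintype.card K := Fintype.one_lt_card
  rcases Nat.eq_zero_or_pos k with rfl | hk
  · have hX : Irreducible (X - 1 : K[X]) ∧ (X - 1 : K[X]).Monic ∧
        (X - 1 : K[X]) ∣ (X : K[X]) ^ u - 1 := by
      refine ⟨?_, ?_, ?_⟩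
      · simpa using irreducible_X_sub_C (1 : K)
      · simpa using monic_X_sub_C (1 : K)
      · simpa using sub_dvd_pow_sub_pow (X : K[X]) 1 u
    have hXJ : (X - 1 : K[X]) ∉ J := by
      intro h
      obtain ⟨-, -, hd⟩ := hJ _ h
      rw [pow_zero, one_mul] at hd
      refine hX.1.not_isUnit (hsep.squarefree _ ?_)
      rw [← geom_sum_mul]
      exact mul_dvd_mul_right hd _
    have := two_pow_card_le_Wpoly hne (I := insert (X - 1) J) (by
      intro g hg
      rcases Finset.mem_insert.1 hg with rfl | hg
      · exact hX
      · exact hJu g hg)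
    rw [Finset.card_insert_of_notMem hXJ, pow_succ] at this
    rw [pow_zero, pow_one]
    nlinarith
  · have hW := two_pow_card_le_Wpoly hne hJu
    have h2 : 2 ≤ p ^ k := hp.two_le.trans (Nat.le_self_pow hk.ne' p)
    calc 2 * (Fintype.card K * 2 ^ J.card) = (2 * Fintype.card K) * 2 ^ J.card := by ring
      _ ≤ Fintype.card K ^ p ^ k * Wpoly ((X : K[X]) ^ u - 1) := by
        refine Nat.mul_le_mul ?_ hW
        calc 2 * Fintype.card K ≤ Fintype.card K ^ 2 := by nlinarith
          _ ≤ _ := Nat.pow_le_pow_right (by omega) h2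

end FactorCount

section Assembly

theorem orderOf_eq_card_sub_one_of_mulChar_ne_one {F : Type*} [Field F] [Fintype F] {w : F}
    (hw : w ≠ 0) (h : ∀ ℓ : ℕ, ℓ.Prime → ℓ ∣ Fintype.card F - 1 →
      ∃ χ : MulChar F ℂ, orderOf χ = ℓ ∧ χ w ≠ 1) :
    orderOf w = Fintype.card F - 1 := by
  classical
  have hpos : 0 < Fintype.card F - 1 := Nat.sub_pos_of_lt Fintype.one_lt_card
  refine orderOf_eq_of_pow_and_pow_div_prime hpos (FiniteField.pow_card_sub_one_eq_one w hw) ?_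
  intro ℓ hℓ hdvd hpow
  obtain ⟨χ, hχ, hne⟩ := h ℓ hℓ hdvd
  obtain ⟨γ, hγ⟩ := IsCyclic.exists_monoid_generator (α := Fˣ)
  have hord : orderOf γ = Fintype.card F - 1 := by
    rw [orderOf_eq_card_of_forall_mem_powers hγ, Nat.card_eq_fintype_card, Fintype.card_units]
  obtain ⟨m, hm⟩ := hγ (Units.mk0 w hw)
  dsimp only at hm
  have hwm : w = (γ : F) ^ m := by
    rw [← Units.val_pow_eq_pow_val, hm, Units.val_mk0]
  obtain ⟨c, hc⟩ := hdvd
  have hc0 : 0 < c := Nat.pos_of_ne_zero fun h0 => hpos.ne' (by rw [hc, h0, mul_zero])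
  have hγpow : γ ^ (m * c) = 1 := by
    rw [hc, Nat.mul_div_cancel_left _ hℓ.pos] at hpow
    rw [pow_mul, hm]
    ext
    simpa using hpow
  have hmdvd : ℓ ∣ m := by
    have := orderOf_dvd_of_pow_eq_one hγpow
    rw [hord, hc] at this
    exact Nat.dvd_of_mul_dvd_mul_right hc0 this
  obtain ⟨d, rfl⟩ := hmdvd
  refine hne ?_
  rw [hwm, mul_comm, pow_mul, map_pow, ← MulChar.pow_apply' χ hℓ.ne_zero, ← hχ, pow_orderOf_eq_one,
    ← Units.val_pow_eq_pow_val, MulChar.one_apply_coe]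

theorem sieve_inequality {r wt B s δ : ℝ} (hr : 1 ≤ r) (hwt : 1 ≤ wt) (hδ : 0 < δ)
    (h : 2 * B * wt * ((s - 1) / δ + 2) < r) :
    (s - 1 + δ) * (wt * B * (2 * r)) < δ * (r ^ 2 - 1 - wt * (B - 1) * (2 * r)) := by
  have hmul := mul_lt_mul_of_pos_right h (mul_pos hδ (by linarith : 0 < r))
  have hclear : 2 * B * wt * ((s - 1) / δ + 2) * (δ * r) =
      2 * B * wt * (s - 1 + 2 * δ) * r := by
    field_simp
  rw [hclear] at hmul
  have hslack : 0 ≤ δ * (2 * (wt * r) - 1) := by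
    refine mul_nonneg hδ.le ?_
    nlinarith
  linarith

/-- The multiplicative sieve combined with the character expansion of the conditions `tr x = 0`
and `π g x ≠ 0`. -/
theorem exists_sieve_addMonoidHom {I J F B : Type*} [Fintype I] [DecidableEq I] [Fintype J]
    [DecidableEq J] [Field F] [Fintype F] [AddCommGroup B] [Fintype B] {χ : I → MulChar F ℂ}
    {r : I → ℕ} (hr : ∀ i, (r i).Prime) (hinj : Function.Injective r)
    (hχ : ∀ i, orderOf (χ i) = r i) {tr : F →+ B} (htr : Function.Surjective tr)
    {π : J → F →+ F} (hπ : ∀ g, ∃ x, tr x = 0 ∧ π g x ≠ 0)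
    (hind : ∀ g x, tr x = 0 → ∃ y, tr y = 0 ∧ π g y = π g x ∧ ∀ h, h ≠ g → π h y = 0)
    (T : Finset I) {δ : ℝ} (hδ : δ = 1 - ∑ i ∈ T, 1 / (r i : ℝ)) (hδ0 : 0 < δ)
    (hineq : 2 * ((Fintype.card B : ℝ) * 2 ^ Fintype.card J) * 2 ^ Tᶜ.card *
      (((T.card : ℝ) - 1) / δ + 2) < √(Fintype.card F)) :
    ∃ w : F, w ≠ 0 ∧ (∀ i, χ i w ≠ 1) ∧ tr (w ^ 2) = 0 ∧ ∀ g, π g (w ^ 2) ≠ 0 := by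
  obtain ⟨κ, hκ, hG⟩ := exists_sum_addSieveChar hπ
  have hcard : (1 : ℝ) ≤ √(Fintype.card F) := by
    rw [Real.one_le_sqrt]
    exact_mod_cast Fintype.card_pos
  have hmain := sieve_inequality hcard (one_le_pow₀ (by norm_num : (1 : ℝ) ≤ 2)) hδ0 hineq
  rw [Real.sq_sqrt (Nat.cast_nonneg _)] at hmain
  set C : AddChar B ℂ × (J → AddChar F ℂ) → ℂ := fun a =>
    ∏ g, addSieveCoeff {x | tr x = 0} (π g) (a.2 g)
  have hC1 : C 1 = 1 := Finset.prod_eq_one fun g _ => addSieveCoeff_one _ _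
  have hψ1 : addSieveChar tr π 1 = 1 := by
    ext x
    simp [addSieveChar_apply]
  have hψ : ∀ a, a ≠ 1 → C a ≠ 0 → addSieveChar tr π a ≠ 1 := fun a ha hC =>
    addSieveChar_ne_one htr hind ha hC
  have hCsum : ∑ a, ‖C a‖ ≤ (Fintype.card B : ℝ) * 2 ^ Fintype.card J :=
    (sum_norm_addSieveCoeff_prod hπ).le
  exact exists_sieve hr hinj hχ hC1 hψ1 hψ hCsum hκ hG T hδ hδ0 hmain

/-- The sieve applied to primitive elements `w` whose square is annihilated precisely by the
multiples of `tracePoly`. -/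
theorem exists_primitive_sq {K L : Type*} [Field K] [Field L] [Algebra K L] [Fintype K]
    [Fintype L] {J : Finset K[X]}
    (hJ : ∀ g, g ∈ J ↔ Irreducible g ∧ g.Monic ∧ g ∣ tracePoly K L)
    {P : Finset ℕ} (hP : P ⊆ (Fintype.card L - 1).primeFactors)
    {δ : ℝ} (hδ : δ = 1 - ∑ ℓ ∈ P, 1 / (ℓ : ℝ)) (hδ0 : 0 < δ)
    (hineq : 2 * ((Fintype.card K : ℝ) * 2 ^ J.card) *
      2 ^ ((Fintype.card L - 1).primeFactors \ P).card * (((P.card : ℝ) - 1) / δ + 2) <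
        √(Fintype.card L)) :
    ∃ w : L, orderOf w = Fintype.card L - 1 ∧ Algebra.trace K L (w ^ 2) = 0 ∧
      ∀ g : K[X], Irreducible g → g.Monic → g ∣ tracePoly K L →
        aeval (frobeniusEnd K L) (tracePoly K L / g) (w ^ 2) ≠ 0 := by
  classical
  set S := (Fintype.card L - 1).primeFactors with hS
  have hχ : ∀ ℓ : S, ∃ χ : MulChar L ℂ, orderOf χ = ℓ := fun ℓ =>
    MulChar.exists_mulChar_orderOf L (Nat.dvd_of_mem_primeFactors ℓ.2)
      (Complex.isPrimitiveRoot_exp ℓ (Nat.prime_of_mem_primeFactors ℓ.2).ne_zero)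
  choose χ hχ using hχ

  let tr : L →+ K := (Algebra.trace K L).toAddMonoidHom
  let π : J → L →+ L := fun g =>
    (aeval (frobeniusEnd K L) (tracePoly K L / (g : K[X]))).toAddMonoidHom
  have hπ0 : ∀ g, ∃ x, tr x = 0 ∧ π g x ≠ 0 := fun g =>
    exists_aeval_tracePoly_div_ne_zero L ((hJ g).1 g.2).1 ((hJ g).1 g.2).2.2
  have hind : ∀ g x, tr x = 0 → ∃ y, tr y = 0 ∧ π g y = π g x ∧ ∀ h, h ≠ g → π h y = 0 := by
    intro g x hx
    obtain ⟨y, h1, h2, h3⟩ :=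
      exists_aeval_tracePoly_div_separate (fun g hg => (hJ g).1 hg) g.2 hx
    exact ⟨y, h1, h2, fun h hh => h3 h h.2 fun e => hh (Subtype.ext e)⟩
  set T : Finset S := P.subtype (· ∈ S) with hT
  have hTmap : T.map (Function.Embedding.subtype _) = P := by
    rw [hT, Finset.subtype_map, Finset.filter_true_of_mem fun x hx => hP hx]
  have hTcard : T.card = P.card := by rw [← hTmap, Finset.card_map]
  have hTc : Tᶜ.card = (S \ P).card := by
    rw [Finset.card_compl, Fintype.card_coe, hTcard, Finset.card_sdiff_of_subset hP]
  have hTsum : δ = 1 - ∑ i ∈ T, 1 / ((i : ℕ) : ℝ) := by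
    rw [hδ, ← hTmap, Finset.sum_map]
    rfl
  rw [← hTc, ← hTcard, ← Fintype.card_coe J] at hineq
  obtain ⟨w, hw, hprim, hgood⟩ := exists_sieve_addMonoidHom
    (fun ℓ : S => Nat.prime_of_mem_primeFactors ℓ.2) Subtype.val_injective hχ
    (Algebra.trace_surjective K L) hπ0 hind T hTsum hδ0 hineq
  refine ⟨w, orderOf_eq_card_sub_one_of_mulChar_ne_one hw fun ℓ hℓ hdvd => ?_, hgood.1,
    fun g hgi hgm hgd => hgood.2 ⟨g, (hJ g).2 ⟨hgi, hgm, hgd⟩⟩⟩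
  have hmem : ℓ ∈ S := Nat.mem_primeFactors.2
    ⟨hℓ, hdvd, (Nat.sub_pos_of_lt Fintype.one_lt_card).ne'⟩
  exact ⟨χ ⟨ℓ, hmem⟩, hχ _, hprim _⟩

end Assembly

/-- Sieving criterion: let `n = p^k u` with `gcd(u, p) = 1`, let `q'` be the largest
squarefree divisor of `q^n - 1`, let `p_1, …, p_s` be distinct primes dividing `q'` with
`δ = 1 - Σ 1/pᵢ > 0`, and `q₀ = q'/(p_1 ⋯ p_s)`. If
`q^{p^k (u/2 - 1)} > W(q₀) W(x^u - 1) ((s-1)/δ + 2)`, then there exists an element of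
`F_{q^n}` that is simultaneously `2`-primitive and `1`-normal over `F_q`. -/
theorem stmt_16 (p t q n k u s q₀ : ℕ) (hp : p.Prime) (hodd : Odd p) (ht : 1 ≤ t)
    (hq : q = p ^ t) (hgcd : Nat.gcd u p = 1) (hn : n = p ^ k * u)
    (pr : Fin s → ℕ) (hpr : ∀ i, (pr i).Prime) (hinj : Function.Injective pr)
    (hdvd : ∀ i, pr i ∣ ∏ ℓ ∈ (q ^ n - 1).primeFactors, ℓ)
    (hδ : (0 : ℝ) < 1 - ∑ i, (1 : ℝ) / (pr i))
    (hq₀ : q₀ = (∏ ℓ ∈ (q ^ n - 1).primeFactors, ℓ) / ∏ i, pr i)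
    (K L : Type*) [Field K] [Field L] [Algebra K L] [Fintype K] [Fintype L]
    (hK : Fintype.card K = q) (hL : Fintype.card L = q ^ n)
    (hineq : (q : ℝ) ^ ((p : ℝ) ^ k * ((u : ℝ) / 2 - 1)) >
      (Wnat q₀ : ℝ) * (Wpoly ((X : Polynomial K) ^ u - 1) : ℝ) *
        (((s : ℝ) - 1) / (1 - ∑ i, (1 : ℝ) / (pr i)) + 2)) :
    ∃ α : L, orderOf α = (q ^ n - 1) / 2 ∧
      Module.finrank K (conjSpan K q n α) = n - 1 := by
  classical
  have hp' : Fact p.Prime := ⟨hp⟩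
  have hq1 : 1 < q := hK ▸ Fintype.one_lt_card
  have hfin : Module.finrank K L = n := by
    have := Module.card_eq_pow_finrank (K := K) (V := L)
    rw [hL, hK] at this
    exact (Nat.pow_right_injective hq1 this).symm
  have hchar : CharP K p := charP_of_card_eq_prime_pow (hK.trans hq)
  have hF0 : tracePoly K L ≠ 0 := (tracePoly_monic K L).ne_zero
  set J : Finset K[X] := (UniqueFactorizationMonoid.normalizedFactors (tracePoly K L)).toFinset
  have hJ : ∀ g, g ∈ J ↔ Irreducible g ∧ g.Monic ∧ g ∣ tracePoly K L := fun g => by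
    rw [Multiset.mem_toFinset, Polynomial.mem_normalizedFactors_iff hF0]
  have hB : 2 * (q * 2 ^ J.card) ≤ q ^ p ^ k * Wpoly ((X : K[X]) ^ u - 1) := by
    rw [← hK]
    refine two_mul_card_mul_two_pow_le hgcd fun g hg => ?_
    rw [← hn, ← hfin]
    exact (hJ g).1 hg
  set S := (q ^ n - 1).primeFactors with hS
  have hSprime : ∀ ℓ ∈ S, ℓ.Prime := fun ℓ hℓ => Nat.prime_of_mem_primeFactors hℓ
  set P : Finset ℕ := Finset.univ.image pr with hPdef
  have hPS : P ⊆ S := by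
    intro ℓ hℓ
    obtain ⟨i, -, rfl⟩ := Finset.mem_image.1 hℓ
    rw [← Nat.primeFactors_prod hSprime]
    exact Nat.mem_primeFactors.2 ⟨hpr i, hdvd i,
      Finset.prod_ne_zero_iff.2 fun ℓ hℓ => (hSprime ℓ hℓ).ne_zero⟩
  have hPcard : P.card = s := by
    rw [hPdef, Finset.card_image_of_injective _ hinj, Finset.card_univ, Fintype.card_fin]
  have hPsum : ∑ i, (1 : ℝ) / (pr i) = ∑ ℓ ∈ P, 1 / (ℓ : ℝ) := by
    rw [hPdef, Finset.sum_image fun i _ j _ hij => hinj hij]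
  have hW : Wnat q₀ = 2 ^ (S \ P).card := by
    have hprod : ∏ i, pr i = ∏ ℓ ∈ P, ℓ := by
      rw [hPdef, Finset.prod_image fun i _ j _ hij => hinj hij]
    rw [hq₀, hprod, ← Finset.prod_sdiff hPS, Nat.mul_div_cancel _
      (Finset.prod_pos fun ℓ hℓ => (hSprime ℓ (hPS hℓ)).pos), Wnat,
      Nat.primeFactors_prod fun ℓ hℓ => hSprime ℓ (Finset.sdiff_subset hℓ)]
  have hfac : 0 ≤ ((s : ℝ) - 1) / (1 - ∑ i, (1 : ℝ) / (pr i)) + 2 := by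
    rcases Nat.eq_zero_or_pos s with rfl | hs
    · norm_num
    · have : (1 : ℝ) ≤ s := by exact_mod_cast hs
      have := div_nonneg (sub_nonneg.2 this) hδ.le
      linarith
  have hq0 : (0 : ℝ) < q := by exact_mod_cast hq1.le
  have hroot : (q : ℝ) ^ p ^ k * (q : ℝ) ^ ((p : ℝ) ^ k * ((u : ℝ) / 2 - 1)) =
      √(Fintype.card L) := by
    rw [hL, hn, Real.sqrt_eq_rpow, Nat.cast_pow, ← Real.rpow_natCast (q : ℝ) (p ^ k),
      ← Real.rpow_natCast (q : ℝ) (p ^ k * u), ← Real.rpow_add hq0, ← Real.rpow_mul hq0.le]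
    push_cast
    congr 1
    ring
  have hBR : 2 * ((q : ℝ) * 2 ^ J.card) ≤ (q : ℝ) ^ p ^ k * Wpoly ((X : K[X]) ^ u - 1) := by
    exact_mod_cast hB
  have hsieve : 2 * ((q : ℝ) * 2 ^ J.card) * 2 ^ (S \ P).card *
      (((P.card : ℝ) - 1) / (1 - ∑ i, (1 : ℝ) / (pr i)) + 2) < √(Fintype.card L) := by
    rw [hPcard]
    rw [hW] at hineq
    push_cast at hineq
    calc _ ≤ (q : ℝ) ^ p ^ k * Wpoly ((X : K[X]) ^ u - 1) * 2 ^ (S \ P).card *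
          (((s : ℝ) - 1) / (1 - ∑ i, (1 : ℝ) / (pr i)) + 2) := by gcongr
      _ = (q : ℝ) ^ p ^ k * (2 ^ (S \ P).card * Wpoly ((X : K[X]) ^ u - 1) *
          (((s : ℝ) - 1) / (1 - ∑ i, (1 : ℝ) / (pr i)) + 2)) := by ring
      _ < _ := by
        rw [← hroot]
        exact mul_lt_mul_of_pos_left hineq (pow_pos hq0 _)
  rw [hS, ← hL] at hPS hsieve
  rw [← hK] at hsieve
  obtain ⟨w, hw, htr, hmin⟩ := exists_primitive_sq hJ hPS (congrArg (1 - ·) hPsum) hδ hsieve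
  refine ⟨w ^ 2, ?_, ?_⟩
  · have heven : 2 ∣ q ^ n - 1 := by
      rw [hq]
      exact (Nat.Odd.sub_odd (hodd.pow.pow) odd_one).two_dvd
    rw [orderOf_pow' w two_ne_zero, hw, hL, Nat.gcd_eq_right heven]
  · have := finrank_conjSpan_of_trace_eq_zero htr hmin
    rwa [hK, hfin] at this
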